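/- Let p be a core (I,J)-coset. If (L_0,…,L_m; s_1,…,s_m) and (L'_0,…,L'_{m'}; s'_1,…,s'_{m'}) are two reduced atomic expressions from I to J both expressing p (that is, x_m = p̄ and x'_{m'} = p̄), then m = m'. -/

import Mathlib

namespace CoxeterAtoms

variable {B : Type*} {W : Type*} [Group W] {M : CoxeterMatrix B}

/-- The standard parabolic subgroup `W_K` generated by the simple reflections indexed by `K`. -/
def par (cs : CoxeterSystem M W) (K : Set B) : Subgroup W :=
  Subgroup.closure (cs.simple '' K)

/-- `K` is finitary if `W_K` is finite. -/
def Finitary (cs : CoxeterSystem M W) (K : Set B) : Prop :=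
  ((par cs K : Set W)).Finite

/-- The left coset `W_I · x`. -/
def lcos (cs : CoxeterSystem M W) (I : Set B) (x : W) : Set W :=
  {w | ∃ a ∈ par cs I, w = a * x}

/-- The right coset `x · W_J`. -/
def rcos (cs : CoxeterSystem M W) (x : W) (J : Set B) : Set W :=
  {w | ∃ b ∈ par cs J, w = x * b}

/-- The double coset `W_I · x · W_J`. -/
def dcos (cs : CoxeterSystem M W) (I : Set B) (x : W) (J : Set B) : Set W :=
  {w | ∃ a ∈ par cs I, ∃ b ∈ par cs J, w = a * x * b}

/-- `x` is a minimal length element of its double coset `W_I · x · W_J`. -/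
def IsMinRep (cs : CoxeterSystem M W) (I : Set B) (x : W) (J : Set B) : Prop :=
  ∀ w ∈ dcos cs I x J, cs.length x ≤ cs.length w

/-- `y` is a maximal length element of the set `p`. -/
def IsMaxOf (cs : CoxeterSystem M W) (p : Set W) (y : W) : Prop :=
  y ∈ p ∧ ∀ w ∈ p, cs.length w ≤ cs.length y

/-- `y` is the longest element of the standard parabolic subgroup `W_K`. -/
def IsLongest (cs : CoxeterSystem M W) (K : Set B) (y : W) : Prop :=
  y ∈ par cs K ∧ ∀ w ∈ par cs K, cs.length w ≤ cs.length y

/-- The double coset `W_I · x · W_J` is core: `W_I·x = W_I·x·W_J = x·W_J`. -/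
def IsCore (cs : CoxeterSystem M W) (I : Set B) (x : W) (J : Set B) : Prop :=
  lcos cs I x = dcos cs I x J ∧ dcos cs I x J = rcos cs x J

/-- A reduced atomic expression `(L_0,…,L_m; s_1,…,s_m)` of width `m` from `I` to `J`,
together with the associated data: the removed letters `t_i`, the longest elements
`w_{L_i}` and `w_{K_i}` (where `K_i = L_{i-1} ∪ {s_i}`), and the partial products `x_i`. -/
structure RAtomExpr (cs : CoxeterSystem M W) (I J : Set B) (m : ℕ) where
  Lset : ℕ → Set B
  letter : ℕ → B
  tletter : ℕ → B
  wL : ℕ → W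
  wK : ℕ → W
  x : ℕ → W
  hL0 : Lset 0 = I
  hLm : Lset m = J
  hwL : ∀ i ≤ m, IsLongest cs (Lset i) (wL i)
  hmem : ∀ i, 1 ≤ i → i ≤ m → letter i ∉ Lset (i - 1)
  hfinK : ∀ i, 1 ≤ i → i ≤ m → Finitary cs (Lset (i - 1) ∪ {letter i})
  hwK : ∀ i, 1 ≤ i → i ≤ m → IsLongest cs (Lset (i - 1) ∪ {letter i}) (wK i)
  ht : ∀ i, 1 ≤ i → i ≤ m →
    cs.simple (tletter i) = wK i * cs.simple (letter i) * wK i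
  hLi : ∀ i, 1 ≤ i → i ≤ m → Lset i = (Lset (i - 1) ∪ {letter i}) \ {tletter i}
  hx0 : x 0 = wL 0
  hx : ∀ i, 1 ≤ i → i ≤ m → x i = x (i - 1) * wL (i - 1) * wK i
  hred : ∀ i, 1 ≤ i → i ≤ m →
    (cs.length (x i) : ℤ) =
      (cs.length (x (i - 1)) : ℤ) - cs.length (wL (i - 1)) + cs.length (wK i)


/-! ### The reflection cocycle -/

section Cocycle

lemma end_mul_apply {α : Type*} (f g : Function.End α) (x : α) : (f * g) x = f (g x) := rfl

lemma end_one_apply {α : Type*} (x : α) : (1 : Function.End α) x = x := rfl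

variable (cs : CoxeterSystem M W)

open Classical in
/-- The action of a simple reflection on signed elements. -/
noncomputable def cocStep (b : B) : Function.End (W × ZMod 2) :=
  fun p => (cs.simple b * p.1 * cs.simple b, p.2 + if p.1 = cs.simple b then 1 else 0)

lemma rot_flip (a b : B) (n : ℕ) :
    (cs.simple a * cs.simple b) ^ n * cs.simple b * (cs.simple a * cs.simple b) ^ n
      = cs.simple b := by
  induction n with
  | zero => simp
  | succ n ih =>
    rw [pow_succ]
    nth_rewrite 2 [← pow_succ]
    rw [pow_succ']
    calc _ = (cs.simple a * cs.simple b) ^ n * (cs.simple a * (cs.simple b * cs.simple b)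
              * cs.simple a * cs.simple b) * (cs.simple a * cs.simple b) ^ n := by
            simp only [mul_assoc]
      _ = _ := by simpa using ih

lemma rot_flip' (a b : B) (n : ℕ) :
    ((cs.simple a * cs.simple b) ^ n)⁻¹ * cs.simple b
      = cs.simple b * (cs.simple a * cs.simple b) ^ n := by
  rw [inv_mul_eq_iff_eq_mul, ← mul_assoc, rot_flip]

open Classical in
lemma cocStep_pow (a b : B) (n : ℕ) (t : W) (e : ZMod 2) :
    ((cocStep cs a * cocStep cs b) ^ n) (t, e) =
      ((cs.simple a * cs.simple b) ^ n * t * ((cs.simple a * cs.simple b) ^ n)⁻¹,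
        e + ∑ j ∈ Finset.range (2 * n),
          if t = cs.simple b * (cs.simple a * cs.simple b) ^ j then 1 else 0) := by
  induction n with
  | zero => simp [end_one_apply]
  | succ n ih =>
    rw [pow_succ', end_mul_apply, ih, end_mul_apply]
    set r := cs.simple a * cs.simple b with hr
    have h1 : (r ^ n * t * (r ^ n)⁻¹ = cs.simple b) ↔ t = cs.simple b * r ^ (2 * n) := by
      rw [mul_inv_eq_iff_eq_mul, ← eq_inv_mul_iff_mul_eq, ← mul_assoc, rot_flip', mul_assoc,
        ← pow_add, two_mul]
    have h2 : (cs.simple b * (r ^ n * t * (r ^ n)⁻¹) * cs.simple b = cs.simple a) ↔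
        t = cs.simple b * r ^ (2 * n + 1) := by
      have : (cs.simple b * (r ^ n * t * (r ^ n)⁻¹) * cs.simple b = cs.simple a) ↔
          r ^ n * t * (r ^ n)⁻¹ = cs.simple b * r := by
        generalize r ^ n * t * (r ^ n)⁻¹ = q
        constructor
        · intro h
          rw [hr, ← h]; simp [mul_assoc]
        · intro h
          rw [h, hr]; simp [mul_assoc]
      rw [this, mul_inv_eq_iff_eq_mul, ← eq_inv_mul_iff_mul_eq, ← mul_assoc, ← mul_assoc,
        rot_flip', mul_assoc, mul_assoc, ← pow_succ', ← pow_add]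
      congr! 3
      ring
    simp only [cocStep, h1, h2]
    rw [show 2 * (n + 1) = 2 * n + 1 + 1 by ring, Finset.sum_range_succ, Finset.sum_range_succ,
      Prod.mk.injEq]
    constructor
    · rw [pow_succ', mul_inv_rev, hr]
      simp [mul_assoc]
    · ring

lemma cocStep_liftable : M.IsLiftable (cocStep cs) := by
  classical
  intro a b
  funext ⟨t, e⟩
  rw [cocStep_pow, cs.simple_mul_simple_pow, two_mul, Finset.sum_range_add]
  have : ∀ j, (cs.simple a * cs.simple b) ^ (M a b + j) = (cs.simple a * cs.simple b) ^ j := by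
    intro j
    rw [pow_add, cs.simple_mul_simple_pow, one_mul]
  simp only [this, CharTwo.add_self_eq_zero]
  simp [end_one_apply]

/-- The Coxeter group acting on signed elements. -/
noncomputable def cocHom : W →* Function.End (W × ZMod 2) :=
  cs.lift ⟨cocStep cs, cocStep_liftable cs⟩

lemma cocHom_simple (b : B) : cocHom cs (cs.simple b) = cocStep cs b :=
  cs.lift_apply_simple _ b

/-- The cocycle: parity of the number of occurrences of `t` among the left inversions of `w`. -/
noncomputable def N (w t : W) : ZMod 2 := (cocHom cs w⁻¹ (t, 0)).2

lemma cocHom_apply (w t : W) (e : ZMod 2) :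
    cocHom cs w (t, e) = (w * t * w⁻¹, e + (cocHom cs w (t, 0)).2) := by
  classical
  induction w using cs.simple_induction_left generalizing t e with
  | one => simp [end_one_apply]
  | mul_simple_left w b ih =>
    rw [map_mul, end_mul_apply, end_mul_apply, ih, ih t 0,
      cocHom_simple]
    simp only [cocStep, Prod.mk.injEq]
    constructor
    · simp [mul_assoc]
    · ring

lemma N_mul (a b t : W) : N cs (a * b) t = N cs a t + N cs b (a⁻¹ * t * a) := by
  unfold N
  rw [mul_inv_rev, map_mul, end_mul_apply, cocHom_apply cs a⁻¹,
    cocHom_apply cs b⁻¹]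
  simp

open Classical in
lemma N_simple (b : B) (t : W) : N cs (cs.simple b) t = if t = cs.simple b then 1 else 0 := by
  unfold N
  rw [cs.inv_simple, cocHom_simple]
  simp [cocStep]

@[simp] lemma N_one (t : W) : N cs 1 t = 0 := by
  simp [N, end_one_apply]

lemma mem_leftInvSeq_of_N (ω : List B) (t : W) (h : N cs (cs.wordProd ω) t ≠ 0) :
    t ∈ cs.leftInvSeq ω := by
  induction ω generalizing t with
  | nil => simp at h
  | cons b ω ih =>
    rw [cs.wordProd_cons, N_mul, N_simple] at h
    by_cases hb : t = cs.simple b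
    · simp [CoxeterSystem.leftInvSeq, hb]
    · rw [if_neg hb, zero_add] at h
      have := ih _ h
      simp only [CoxeterSystem.leftInvSeq, List.mem_cons, List.mem_map]
      right
      exact ⟨_, this, by simp [mul_assoc]⟩

lemma length_lt_of_N {w t : W} (h : N cs w t ≠ 0) :
    cs.length (t * w) < cs.length w := by
  obtain ⟨ω, hω, rfl⟩ := cs.exists_isReduced w
  exact (cs.isLeftInversion_of_mem_leftInvSeq hω (mem_leftInvSeq_of_N cs ω t h)).2

lemma N_self {t : W} (ht : cs.IsReflection t) : N cs t t = 1 := by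
  obtain ⟨w, b, rfl⟩ := ht
  have h := N_mul cs w w⁻¹ (w * cs.simple b * w⁻¹)
  rw [mul_inv_cancel, N_one] at h
  rw [N_mul, N_mul, N_simple]
  have e1 : w⁻¹ * (w * cs.simple b * w⁻¹) * w = cs.simple b := by group
  have e2 : (w * cs.simple b)⁻¹ * (w * cs.simple b * w⁻¹) * (w * cs.simple b) = cs.simple b := by
    group
  rw [e1] at h ⊢
  rw [e2, if_pos rfl, add_right_comm, ← h, zero_add]

lemma zmod2_cases (x : ZMod 2) : x = 0 ∨ x = 1 := by
  revert x; decide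

lemma N_ne_zero_iff {t : W} (ht : cs.IsReflection t) (w : W) :
    N cs w t ≠ 0 ↔ cs.length (t * w) < cs.length w := by
  refine ⟨length_lt_of_N cs, fun h h0 => ?_⟩
  have h1 : N cs (t * w) t ≠ 0 := by
    rw [N_mul, N_self cs ht]
    simp [h0]
  have := length_lt_of_N cs h1
  rw [← mul_assoc, ht.mul_self, one_mul] at this
  omega

lemma N_eq_one_iff {t : W} (ht : cs.IsReflection t) (w : W) :
    N cs w t = 1 ↔ cs.length (t * w) < cs.length w := by
  rw [← N_ne_zero_iff cs ht]
  rcases zmod2_cases (N cs w t) with h | h <;> simp [h]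

lemma N_eq_zero_iff {t : W} (ht : cs.IsReflection t) (w : W) :
    N cs w t = 0 ↔ cs.length w < cs.length (t * w) := by
  rw [← not_iff_not, ← ne_eq, N_ne_zero_iff cs ht]
  have := ht.length_mul_right_ne w
  omega

end Cocycle

/-! ### Injectivity of the simple reflections, via the geometric representation -/

section Injective

open Polynomial.Chebyshev in
lemma pow_refl_eq_one {V : Type*} [AddCommGroup V] [Module ℝ V] {x y : V}
    {f g : Module.Dual ℝ V} (hf : f x = 2) (hg : g y = 2) (m : ℕ) (hm : 2 ≤ m)
    (h1 : f y = -2 * Real.cos (Real.pi / m)) (h2 : g x = -2 * Real.cos (Real.pi / m)) :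
    (Module.reflection hf * Module.reflection hg) ^ m = 1 := by
  ext z
  rcases hm.eq_or_lt with rfl | hm
  · have e1 : f y = 0 := by rw [h1]; simp
    have e2 : g x = 0 := by rw [h2]; simp
    simp only [pow_two, LinearEquiv.mul_apply, Module.reflection_apply, map_sub, map_smul, hf, hg,
      e1, e2]
    simp only [LinearEquiv.coe_one, id]
    module
  · set θ : ℝ := 2 * (Real.pi / m) with hθ
    have hm0 : (3 : ℝ) ≤ m := by exact_mod_cast hm
    have hpos : 0 < Real.pi / m := by positivity
    have hlt : θ < Real.pi := by
      rw [hθ, ← mul_div_assoc, div_lt_iff₀ (by linarith)]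
      nlinarith [Real.pi_pos]
    have hs : Real.sin θ ≠ 0 := (Real.sin_pos_of_pos_of_lt_pi (by linarith) hlt).ne'
    have ht : 2 * Real.cos θ = f y * g x - 2 := by
      rw [h1, h2, hθ, Real.cos_two_mul]; ring
    have hmθ : (m : ℝ) * θ = 2 * Real.pi := by
      rw [hθ]; field_simp
    rw [Module.reflection_mul_reflection_pow_apply hf hg m z _ ht]
    rcases Nat.even_or_odd' m with ⟨k, rfl | rfl⟩
    · have hk : (S ℝ ((k : ℤ) - 1)).eval (2 * Real.cos θ) = 0 := by
        have := S_two_mul_real_cos θ ((k : ℤ) - 1)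
        have h3 : ((((k : ℤ) - 1 : ℤ) : ℝ) + 1) * θ = Real.pi := by
          push_cast at hmθ ⊢; linarith
        rw [h3, Real.sin_pi] at this
        exact (mul_eq_zero.mp this).resolve_right hs
      have i1 : (((2 * k : ℕ) : ℤ) - 2) / 2 = (k : ℤ) - 1 := by omega
      have i2 : (((2 * k : ℕ) : ℤ) - 1) / 2 = (k : ℤ) - 1 := by omega
      rw [i1, i2, hk]
      simp
    · have hk : (S ℝ (k : ℤ)).eval (2 * Real.cos θ) + (S ℝ ((k : ℤ) - 1)).eval (2 * Real.cos θ)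
          = 0 := by
        have e1 := S_two_mul_real_cos θ ((k : ℤ) - 1)
        have e2 := S_two_mul_real_cos θ (k : ℤ)
        have h3 : (((k : ℤ) : ℝ) + 1) * θ = 2 * Real.pi - (k * θ) := by
          push_cast at hmθ ⊢; linarith
        have h4 : ((((k : ℤ) - 1 : ℤ) : ℝ) + 1) * θ = k * θ := by
          push_cast; ring
        rw [h3, Real.sin_two_pi_sub] at e2
        rw [h4] at e1
        have : ((S ℝ (k : ℤ)).eval (2 * Real.cos θ) + (S ℝ ((k : ℤ) - 1)).eval (2 * Real.cos θ))
          * Real.sin θ = 0 := by rw [add_mul, e1, e2]; ring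
        exact (mul_eq_zero.mp this).resolve_right hs
      have i1 : (((2 * k + 1 : ℕ) : ℤ) - 1) / 2 = (k : ℤ) := by omega
      have i2 : (((2 * k + 1 : ℕ) : ℤ) - 3) / 2 = (k : ℤ) - 1 := by omega
      have i3 : (((2 * k + 1 : ℕ) : ℤ)) / 2 = (k : ℤ) := by omega
      have i4 : (((2 * k + 1 : ℕ) : ℤ) - 2) / 2 = (k : ℤ) - 1 := by omega
      rw [i1, i2, i3, i4, hk]
      simp

/-- The Cartan-type functional of the geometric representation. -/
noncomputable def geoDual (M : CoxeterMatrix B) (a : B) : Module.Dual ℝ (B →₀ ℝ) :=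
  Finsupp.lift ℝ ℝ B (fun b => -2 * Real.cos (Real.pi / M a b))

lemma geoDual_single (a b : B) :
    geoDual M a (Finsupp.single b 1) = -2 * Real.cos (Real.pi / M a b) := by
  simp [geoDual]

lemma geoDual_self (a : B) : geoDual M a (Finsupp.single a 1) = 2 := by
  rw [geoDual_single, M.diagonal]; simp

/-- The geometric representation on generators. -/
noncomputable def geoRefl (M : CoxeterMatrix B) (a : B) : (B →₀ ℝ) ≃ₗ[ℝ] (B →₀ ℝ) :=
  Module.reflection (geoDual_self (M := M) a)

lemma geoRefl_liftable : M.IsLiftable (geoRefl M) := by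
  intro a b
  by_cases hab : a = b
  · subst hab
    rw [M.diagonal, pow_one]
    ext1 z
    exact Module.involutive_reflection (geoDual_self (M := M) a) z
  · by_cases h0 : M a b = 0
    · rw [h0, pow_zero]
    · have h1 := M.off_diagonal a b hab
      exact pow_refl_eq_one (geoDual_self (M := M) a) (geoDual_self (M := M) b) (M a b) (by omega)
        (geoDual_single a b) (by rw [geoDual_single, M.symmetric])

lemma simple_inj (cs : CoxeterSystem M W) : Function.Injective cs.simple := by
  intro a b h
  by_contra hab
  have h1 : geoRefl M a = geoRefl M b := by
    rw [← cs.lift_apply_simple geoRefl_liftable a, h, cs.lift_apply_simple]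
  have h2 := congrArg (fun φ => φ (Finsupp.single a 1) a) h1
  simp only [geoRefl, Module.reflection_apply, geoDual_self] at h2
  have hba : ¬ b = a := fun h => hab h.symm
  simp [hba] at h2

end Injective
/-! ### Standard parabolic subgroups -/

section Parabolic

variable (cs : CoxeterSystem M W)

lemma simple_mem_par {K : Set B} {b : B} (hb : b ∈ K) : cs.simple b ∈ par cs K :=
  Subgroup.subset_closure ⟨b, hb, rfl⟩

lemma par_mono {K K' : Set B} (h : K ⊆ K') : par cs K ≤ par cs K' :=
  Subgroup.closure_mono (Set.image_mono h)

lemma wordProd_mem_par {K : Set B} {ω : List B} (h : ∀ b ∈ ω, b ∈ K) :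
    cs.wordProd ω ∈ par cs K := by
  induction ω with
  | nil => simp
  | cons b ω ih =>
    rw [cs.wordProd_cons]
    exact mul_mem (simple_mem_par cs (h b (by simp))) (ih fun c hc => h c (by simp [hc]))

/-- Elements of `W_K` have reduced words in `K`. -/
lemma exists_reduced_word {K : Set B} {w : W} (hw : w ∈ par cs K) :
    ∃ ω : List B, (∀ b ∈ ω, b ∈ K) ∧ cs.IsReduced ω ∧ w = cs.wordProd ω := by
  have step : ∀ b ∈ K, ∀ w, (∃ ω : List B, (∀ b ∈ ω, b ∈ K) ∧ cs.IsReduced ω ∧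
      w = cs.wordProd ω) → (∃ ω : List B, (∀ b ∈ ω, b ∈ K) ∧ cs.IsReduced ω ∧
      cs.simple b * w = cs.wordProd ω) := by
    rintro b hb w ⟨ω, hK, hr, rfl⟩
    rcases cs.length_simple_mul (cs.wordProd ω) b with h | h
    · refine ⟨b :: ω, ?_, ?_, (cs.wordProd_cons b ω).symm⟩
      · intro c hc
        rcases List.mem_cons.mp hc with rfl | hc
        · exact hb
        · exact hK c hc
      · unfold CoxeterSystem.IsReduced
        rw [cs.wordProd_cons, h, hr.eq, List.length_cons]
    · have hN : N cs (cs.wordProd ω) (cs.simple b) ≠ 0 :=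
        (N_ne_zero_iff cs (cs.isReflection_simple b) _).mpr (by omega)
      obtain ⟨j, hj, hj'⟩ := List.mem_iff_getElem.mp (mem_leftInvSeq_of_N cs ω _ hN)
      have e : cs.simple b * cs.wordProd ω = cs.wordProd (ω.eraseIdx j) := by
        rw [← cs.getD_leftInvSeq_mul_wordProd, List.getD_eq_getElem _ 1 hj, hj']
      rw [cs.length_leftInvSeq] at hj
      refine ⟨ω.eraseIdx j, fun c hc => hK c (List.mem_of_mem_eraseIdx hc), ?_, e⟩
      unfold CoxeterSystem.IsReduced
      have := List.length_eraseIdx_add_one hj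
      rw [← e]
      have := hr.eq
      omega
  induction hw using Subgroup.closure_induction_left with
  | one => exact ⟨[], by simp, by simp [CoxeterSystem.IsReduced], by simp⟩
  | mul_left x hx y hy ih =>
    obtain ⟨b, hb, rfl⟩ := hx
    exact step b hb y ih
  | inv_mul_cancel x hx y hy ih =>
    obtain ⟨b, hb, rfl⟩ := hx
    rw [cs.inv_simple]
    exact step b hb y ih

/-- Induction along reduced words in a parabolic subgroup. -/
lemma par_induction {K : Set B} {p : (w : W) → w ∈ par cs K → Prop} (h1 : p 1 (one_mem _))
    (hs : ∀ (b : B) (hb : b ∈ K) (u : W) (hu : u ∈ par cs K),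
      cs.length u < cs.length (cs.simple b * u) → p u hu →
      p (cs.simple b * u) (mul_mem (simple_mem_par cs hb) hu)) {w : W} (hw : w ∈ par cs K) :
    p w hw := by
  obtain ⟨ω, hK, hr, rfl⟩ := exists_reduced_word cs hw
  induction ω with
  | nil => simpa using h1
  | cons b ω ih =>
    have hr' : cs.IsReduced ω := by simpa using hr.drop 1
    have hK' : ∀ c ∈ ω, c ∈ K := fun c hc => hK c (by simp [hc])
    simp only [cs.wordProd_cons]
    refine hs b (hK b (by simp)) _ (wordProd_mem_par cs hK') ?_ (ih hK' hr' _)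
    rw [← cs.wordProd_cons, hr.eq, hr'.eq, List.length_cons]
    omega

lemma length_one_par {K : Set B} {w : W} (hw : w ∈ par cs K) (h1 : cs.length w = 1) :
    ∃ b ∈ K, w = cs.simple b := by
  obtain ⟨ω, hK, hr, rfl⟩ := exists_reduced_word cs hw
  rw [hr.eq, List.length_eq_one_iff] at h1
  obtain ⟨b, rfl⟩ := h1
  exact ⟨b, hK b (by simp), by simp⟩

lemma mem_of_simple_mem_par {K : Set B} {b : B} (h : cs.simple b ∈ par cs K) : b ∈ K := by
  obtain ⟨c, hc, e⟩ := length_one_par cs h (cs.length_simple b)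
  rwa [simple_inj cs e]

/-- Left inversions of elements of `W_K` lie in `W_K`. -/
lemma mem_par_of_N {K : Set B} {w t : W} (hw : w ∈ par cs K) (h : N cs w t ≠ 0) :
    t ∈ par cs K := by
  induction hw using par_induction cs generalizing t with
  | h1 => simp at h
  | hs b hb u hu _ ih =>
    rw [N_mul, N_simple] at h
    by_cases e : t = cs.simple b
    · rw [e]; exact simple_mem_par cs hb
    · rw [if_neg e, zero_add] at h
      have h2 := ih h
      have hb' := simple_mem_par cs hb
      have := mul_mem (mul_mem hb' h2) (inv_mem hb')
      convert this using 1
      group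

/-- Additivity of lengths for minimal coset representatives. -/
lemma length_mul_min {K : Set B} {d : W} (hd : ∀ u ∈ par cs K, cs.length d ≤ cs.length (u * d))
    {u : W} (hu : u ∈ par cs K) : cs.length (u * d) = cs.length u + cs.length d := by
  induction hu using par_induction cs with
  | h1 => simp
  | hs b hb u hu hlt ih =>
    have hr := cs.isReflection_simple b
    have h1 : N cs u (cs.simple b) = 0 := (N_eq_zero_iff cs hr _).mpr hlt
    have hr2 : cs.IsReflection (u⁻¹ * cs.simple b * u) := by simpa using hr.conj u⁻¹
    have hmem : u⁻¹ * cs.simple b * u ∈ par cs K :=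
      mul_mem (mul_mem (inv_mem hu) (simple_mem_par cs hb)) hu
    have h2 : N cs d (u⁻¹ * cs.simple b * u) = 0 := by
      rw [N_eq_zero_iff cs hr2]
      exact lt_of_le_of_ne (hd _ hmem) (hr2.length_mul_right_ne d).symm
    have h3 : N cs (u * d) (cs.simple b) = 0 := by rw [N_mul, h1, h2, add_zero]
    rw [N_eq_zero_iff cs hr] at h3
    rw [mul_assoc]
    have := cs.length_simple_mul (u * d) b
    have := cs.length_simple_mul u b
    omega

lemma length_mul_min' {K : Set B} {d : W} (hd : ∀ u ∈ par cs K, cs.length d ≤ cs.length (d * u))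
    {u : W} (hu : u ∈ par cs K) : cs.length (d * u) = cs.length d + cs.length u := by
  have := length_mul_min cs (K := K) (d := d⁻¹) (fun v hv => by
    have := hd v⁻¹ (inv_mem hv)
    rw [← cs.length_inv (d * v⁻¹)] at this
    simpa using this) (inv_mem hu)
  rw [← mul_inv_rev, cs.length_inv, cs.length_inv, cs.length_inv] at this
  omega

/-- Existence of a minimal double coset representative. -/
lemma exists_min (K N' : Set B) (g : W) : ∃ a ∈ par cs K, ∃ d, ∃ b ∈ par cs N', g = a * d * b ∧
    (∀ u ∈ par cs K, cs.length d ≤ cs.length (u * d)) ∧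
    (∀ u ∈ par cs N', cs.length d ≤ cs.length (d * u)) := by
  let D : Set W := {d | ∃ a ∈ par cs K, ∃ b ∈ par cs N', g = a * d * b}
  have hne : D.Nonempty := ⟨g, 1, one_mem _, 1, one_mem _, by simp⟩
  obtain ⟨d, ⟨a, ha, b, hb, e⟩, hmin⟩ := exists_minimalFor_of_wellFoundedLT (· ∈ D) cs.length hne
  have hmin' : ∀ d' ∈ D, cs.length d ≤ cs.length d' := by
    intro d' hd'
    by_contra hc
    exact hc (hmin hd' (by omega))
  refine ⟨a, ha, d, b, hb, e, fun u hu => hmin' _ ?_, fun u hu => hmin' _ ?_⟩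
  · exact ⟨a * u⁻¹, mul_mem ha (inv_mem hu), b, hb, by rw [e]; group⟩
  · exact ⟨a, ha, u⁻¹ * b, mul_mem (inv_mem hu) hb, by rw [e]; group⟩

/-- Kilmoyer's theorem: the intersection `W_K ∩ d W_N d⁻¹` is a standard parabolic subgroup. -/
lemma kilmoyer {K N' : Set B} {d : W} (h1 : ∀ u ∈ par cs K, cs.length d ≤ cs.length (u * d))
    {u : W} (hu : u ∈ par cs K) (hv : d⁻¹ * u * d ∈ par cs N') :
    u ∈ par cs {b ∈ K | d⁻¹ * cs.simple b * d ∈ par cs N'} := by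
  induction hu using par_induction cs with
  | h1 => exact one_mem _
  | hs b hb u hu hlt ih =>
    have hr := cs.isReflection_simple b
    have hbK := simple_mem_par cs hb
    set w := cs.simple b * u with hw
    have hN : N cs (w * d) (cs.simple b) ≠ 0 := by
      rw [N_ne_zero_iff cs hr]
      have e : cs.simple b * (w * d) = u * d := by simp [hw, mul_assoc]
      rw [e, length_mul_min cs h1 hu, length_mul_min cs h1 (mul_mem hbK hu), ← hw]
      omega
    have e : w * d = d * (d⁻¹ * w * d) := by group
    have h0 : N cs d (cs.simple b) = 0 := by
      rw [N_eq_zero_iff cs hr]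
      exact lt_of_le_of_ne (h1 _ hbK) (hr.length_mul_right_ne d).symm
    rw [e, N_mul, h0, zero_add] at hN
    have hm := mem_par_of_N cs hv hN
    refine mul_mem (simple_mem_par cs ⟨hb, hm⟩) (ih ?_)
    have := mul_mem (inv_mem hm) hv
    convert this using 1
    rw [hw]; group

/-- A parabolic subgroup containing `W_L` and an element of `W_{L ∪ {s}}` outside `W_L`
contains `W_{L ∪ {s}}`. -/
lemma par_le_of_mem {L N' : Set B} {s : B} (hfin : Finitary cs (L ∪ {s})) (g : W)
    (hL : ∀ w ∈ par cs L, g⁻¹ * w * g ∈ par cs N') {u : W} (hu : u ∈ par cs (L ∪ {s}))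
    (huL : u ∉ par cs L) (hug : g⁻¹ * u * g ∈ par cs N') :
    ∀ w ∈ par cs (L ∪ {s}), g⁻¹ * w * g ∈ par cs N' := by
  set K := L ∪ {s} with hK
  have hLK : par cs L ≤ par cs K := par_mono cs Set.subset_union_left
  obtain ⟨a, ha, d, b, hb, rfl, hd1, hd2⟩ := exists_min cs K N' g
  have key : ∀ w, (a * d * b)⁻¹ * w * (a * d * b) ∈ par cs N' ↔
      d⁻¹ * (a⁻¹ * w * a) * d ∈ par cs N' := by
    intro w
    have e : (a * d * b)⁻¹ * w * (a * d * b) = b⁻¹ * (d⁻¹ * (a⁻¹ * w * a) * d) * b := by group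
    rw [e, Subgroup.mul_mem_cancel_right _ hb, Subgroup.mul_mem_cancel_left _ (inv_mem hb)]
  simp only [key] at hL hug ⊢
  set A : Set B := {b ∈ K | d⁻¹ * cs.simple b * d ∈ par cs N'} with hA
  have hconj : ∀ w ∈ par cs K, a⁻¹ * w * a ∈ par cs K := fun w hw =>
    mul_mem (mul_mem (inv_mem ha) hw) ha
  have hLA : ∀ w ∈ par cs L, a⁻¹ * w * a ∈ par cs A := fun w hw =>
    kilmoyer cs hd1 (hconj w (hLK hw)) (hL w hw)
  have huA : a⁻¹ * u * a ∈ par cs A := kilmoyer cs hd1 (hconj u hu) hug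
  by_cases hAK : A = K
  · intro w hw
    have h1 : a⁻¹ * w * a ∈ par cs A := by rw [hAK]; exact hconj w hw
    generalize a⁻¹ * w * a = v at h1
    have h2 : par cs A ≤ (par cs N').comap (MulAut.conj d⁻¹).toMonoidHom := by
      conv_lhs => unfold par
      rw [Subgroup.closure_le]
      rintro _ ⟨c, hc, rfl⟩
      simpa using hc.2
    simpa using h2 h1
  · exfalso
    obtain ⟨l, hl, e, r, hr, rfl, he1, he2⟩ := exists_min cs L A a
    have key2 : ∀ w, (l * e * r)⁻¹ * w * (l * e * r) ∈ par cs A ↔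
        e⁻¹ * (l⁻¹ * w * l) * e ∈ par cs A := by
      intro w
      have e' : (l * e * r)⁻¹ * w * (l * e * r) = r⁻¹ * (e⁻¹ * (l⁻¹ * w * l) * e) * r := by group
      rw [e', Subgroup.mul_mem_cancel_right _ hr, Subgroup.mul_mem_cancel_left _ (inv_mem hr)]
    simp only [key2] at hLA huA
    have hLA' : ∀ w ∈ par cs L, e⁻¹ * w * e ∈ par cs A := by
      intro w hw
      have := hLA (l * w * l⁻¹) (mul_mem (mul_mem hl hw) (inv_mem hl))
      convert this using 1
      group
    have hfinK : (cs.simple '' K).Finite := hfin.subset (by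
      rintro _ ⟨c, hc, rfl⟩; exact simple_mem_par cs hc)
    have hKfin : K.Finite := hfinK.of_finite_image (simple_inj cs).injOn
    have hAsub : A ⊆ K := fun c hc => hc.1
    have hAfin : A.Finite := hKfin.subset hAsub
    have hLfin : L.Finite := hKfin.subset Set.subset_union_left
    have hcardA : A.ncard < K.ncard :=
      Set.ncard_lt_ncard (hAsub.ssubset_of_ne hAK) hKfin
    have hcardK : K.ncard ≤ L.ncard + 1 := by
      have := Set.ncard_union_le L {s}
      rwa [Set.ncard_singleton] at this
    -- conjugation by `e` sends simple reflections of `L` to simple reflections of `A`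
    have hmap : ∀ c ∈ L, ∃ c' ∈ A, e⁻¹ * cs.simple c * e = cs.simple c' := by
      intro c hc
      have hm := hLA' _ (simple_mem_par cs hc)
      apply length_one_par cs hm
      have h1 := length_mul_min cs he1 (simple_mem_par cs hc)
      have h2 := length_mul_min' cs he2 hm
      have h3 : e * (e⁻¹ * cs.simple c * e) = cs.simple c * e := by group
      rw [h3, h1, cs.length_simple] at h2
      omega
    choose! φ hφA hφ using hmap
    have hinj : Set.InjOn φ L := by
      intro c hc c' hc' h
      have h1 := hφ c hc
      rw [h, ← hφ c' hc'] at h1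
      exact simple_inj cs (mul_left_cancel (mul_right_cancel h1))
    have himg : φ '' L = A := by
      apply Set.eq_of_subset_of_ncard_le _ _ hAfin
      · rintro _ ⟨c, hc, rfl⟩
        exact hφA c hc
      · rw [hinj.ncard_image]
        omega
    have h2 : par cs A ≤ (par cs L).comap (MulAut.conj e).toMonoidHom := by
      conv_lhs => unfold par
      rw [Subgroup.closure_le]
      rintro _ ⟨c, hc, rfl⟩
      rw [← himg] at hc
      obtain ⟨c, hc, rfl⟩ := hc
      have : e * cs.simple (φ c) * e⁻¹ = cs.simple c := by
        rw [← hφ c hc]; group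
      simp only [Subgroup.coe_comap, Set.mem_preimage, SetLike.mem_coe, MulEquiv.coe_toMonoidHom,
        MulAut.conj_apply, this]
      exact simple_mem_par cs hc
    have h3 := h2 huA
    simp only [Subgroup.mem_comap, MulEquiv.coe_toMonoidHom, MulAut.conj_apply] at h3
    have h4 : e * (e⁻¹ * (l⁻¹ * u * l) * e) * e⁻¹ = l⁻¹ * u * l := by group
    rw [h4, Subgroup.mul_mem_cancel_right _ hl, Subgroup.mul_mem_cancel_left _ (inv_mem hl)] at h3
    exact huL h3

end Parabolic

/-! ### Longest elements -/

section Longest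

variable (cs : CoxeterSystem M W)

lemma IsLongest.inv {cs : CoxeterSystem M W} {K : Set B} {w : W} (h : IsLongest cs K w) :
    IsLongest cs K w⁻¹ :=
  ⟨inv_mem h.1, fun v hv => by rw [cs.length_inv]; exact h.2 v hv⟩

lemma IsLongest.N_eq_one {cs : CoxeterSystem M W} {K : Set B} {w t : W} (h : IsLongest cs K w)
    (ht : cs.IsReflection t) (htK : t ∈ par cs K) : N cs w t = 1 := by
  rw [N_eq_one_iff cs ht]
  exact lt_of_le_of_ne (h.2 _ (mul_mem htK h.1)) (ht.length_mul_right_ne w)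

lemma IsLongest.length_mul {cs : CoxeterSystem M W} {K : Set B} {w u : W} (h : IsLongest cs K w)
    (hu : u ∈ par cs K) : cs.length (u * w) + cs.length u = cs.length w := by
  induction hu using par_induction cs with
  | h1 => simp
  | hs b hb u hu hlt ih =>
    have hr := cs.isReflection_simple b
    have h1 : N cs u (cs.simple b) = 0 := (N_eq_zero_iff cs hr _).mpr hlt
    have hr2 : cs.IsReflection (u⁻¹ * cs.simple b * u) := by simpa using hr.conj u⁻¹
    have hmem : u⁻¹ * cs.simple b * u ∈ par cs K :=
      mul_mem (mul_mem (inv_mem hu) (simple_mem_par cs hb)) hu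
    have h3 : N cs (u * w) (cs.simple b) = 1 := by
      rw [N_mul, h1, h.N_eq_one hr2 hmem, zero_add]
    rw [N_eq_one_iff cs hr] at h3
    rw [mul_assoc]
    have := cs.length_simple_mul (u * w) b
    have := cs.length_simple_mul u b
    omega

lemma IsLongest.unique {cs : CoxeterSystem M W} {K : Set B} {w w' : W} (h : IsLongest cs K w)
    (h' : IsLongest cs K w') : w = w' := by
  have h1 := h.length_mul (mul_mem h'.1 (inv_mem h.1))
  rw [inv_mul_cancel_right] at h1
  have h2 := h'.2 _ h.1
  have h3 : cs.length (w' * w⁻¹) = 0 := by omega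
  rw [cs.length_eq_zero_iff, mul_inv_eq_one] at h3
  exact h3.symm

lemma IsLongest.inv_eq {cs : CoxeterSystem M W} {K : Set B} {w : W} (h : IsLongest cs K w) :
    w⁻¹ = w := h.inv.unique h

lemma IsLongest.mul_self {cs : CoxeterSystem M W} {K : Set B} {w : W} (h : IsLongest cs K w) :
    w * w = 1 := by
  nth_rewrite 1 [← h.inv_eq]
  simp

lemma IsLongest.length_mul' {cs : CoxeterSystem M W} {K : Set B} {w u : W} (h : IsLongest cs K w)
    (hu : u ∈ par cs K) : cs.length (w * u) + cs.length u = cs.length w := by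
  have := h.length_mul (inv_mem hu)
  rw [← cs.length_inv, mul_inv_rev, h.inv_eq, inv_inv, cs.length_inv] at this
  exact this

lemma IsLongest.length_conj {cs : CoxeterSystem M W} {K : Set B} {w u : W} (h : IsLongest cs K w)
    (hu : u ∈ par cs K) : cs.length (w * u * w) = cs.length u := by
  have h1 := h.length_mul' hu
  have h2 := h.length_mul (mul_mem h.1 hu)
  omega

lemma IsLongest.conj_simple {cs : CoxeterSystem M W} {K : Set B} {w : W} (h : IsLongest cs K w)
    {b : B} (hb : b ∈ K) : ∃ c ∈ K, w * cs.simple b * w = cs.simple c := by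
  have hb' := simple_mem_par cs hb
  apply length_one_par cs (mul_mem (mul_mem h.1 hb') h.1)
  rw [h.length_conj hb', cs.length_simple]

/-- Conjugation by `w_K` sends `W_{K ∖ t}` to `W_{K ∖ s}`, one direction. -/
lemma conj_par_le {K L L' : Set B} {w : W} (h : IsLongest cs K w) {s t : B}
    (hst : cs.simple t = w * cs.simple s * w) (hL : L ⊆ K) (hsL : s ∉ L)
    (hL' : K \ {t} ⊆ L') {u : W} (hu : u ∈ par cs L) : w * u * w ∈ par cs L' := by
  have h2 : par cs L ≤ (par cs L').comap (MulAut.conj w).toMonoidHom := by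
    conv_lhs => unfold par
    rw [Subgroup.closure_le]
    rintro _ ⟨b, hb, rfl⟩
    obtain ⟨c, hc, e⟩ := h.conj_simple (hL hb)
    simp only [Subgroup.coe_comap, Set.mem_preimage, SetLike.mem_coe, MulEquiv.coe_toMonoidHom,
      MulAut.conj_apply, h.inv_eq, e]
    refine simple_mem_par cs (hL' ⟨hc, ?_⟩)
    rintro rfl
    rw [hst] at e
    have := simple_inj cs (mul_left_cancel (mul_right_cancel e))
    exact hsL (this ▸ hb)
  have h3 := h2 hu
  simpa [h.inv_eq] using h3

end Longest

/-! ### Atomic expressions -/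

section Atomic

variable {cs : CoxeterSystem M W} {I J : Set B} {m : ℕ} (E : RAtomExpr cs I J m)

/-- The minimal representative of the `i`-th partial coset. -/
def zz (i : ℕ) : W := E.x i * E.wL i

lemma zz_zero : zz E 0 = 1 := by
  rw [zz, E.hx0, (E.hwL 0 (Nat.zero_le _)).mul_self]

lemma wK_facts {i : ℕ} (hi : i < m) :
    IsLongest cs (E.Lset i ∪ {E.letter (i + 1)}) (E.wK (i + 1)) ∧
    (∀ u ∈ par cs (E.Lset i),
      E.wK (i + 1) * u * E.wK (i + 1) ∈ par cs (E.Lset (i + 1))) ∧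
    (∀ u ∈ par cs (E.Lset (i + 1)),
      E.wK (i + 1) * u * E.wK (i + 1) ∈ par cs (E.Lset i)) ∧
    E.Lset (i + 1) ⊆ E.Lset i ∪ {E.letter (i + 1)} ∧
    E.letter (i + 1) ∉ E.Lset i := by
  have h1 : 1 ≤ i + 1 := by omega
  have h2 : i + 1 ≤ m := hi
  have hK := E.hwK (i + 1) h1 h2
  have hL := E.hLi (i + 1) h1 h2
  have ht := E.ht (i + 1) h1 h2
  have hm := E.hmem (i + 1) h1 h2
  rw [Nat.add_sub_cancel] at hK hL hm
  refine ⟨hK, fun u hu => ?_, fun u hu => ?_, ?_, hm⟩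
  · exact conj_par_le cs hK ht Set.subset_union_left hm hL.ge hu
  · refine conj_par_le cs hK (s := E.tletter (i + 1)) (t := E.letter (i + 1)) ?_ ?_ ?_ ?_ hu
    · rw [ht]
      have := hK.mul_self
      calc _ = (1 : W) * cs.simple (E.letter (i + 1)) * 1 := by simp
        _ = _ := by rw [← this]; simp only [mul_assoc]
    · rw [hL]; exact Set.diff_subset
    · rw [hL]; simp
    · rintro c ⟨hc | hc, hc'⟩
      · exact hc
      · exact absurd hc hc'
  · rw [hL]; exact Set.diff_subset

lemma wK_mul_wL {i : ℕ} (hi : i < m) :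
    E.wK (i + 1) * E.wL (i + 1) * E.wK (i + 1) = E.wL i := by
  obtain ⟨hK, h1, h2, hsub, -⟩ := wK_facts E hi
  have hL := E.hwL i hi.le
  have hL' := E.hwL (i + 1) hi
  refine IsLongest.unique (cs := cs) (K := E.Lset i) ⟨h2 _ hL'.1, fun v hv => ?_⟩ hL
  rw [hK.length_conj (par_mono cs hsub hL'.1),
    ← hK.length_conj (par_mono cs Set.subset_union_left hv)]
  exact hL'.2 _ (h1 v hv)

lemma length_wL {i : ℕ} (hi : i < m) : cs.length (E.wL (i + 1)) = cs.length (E.wL i) := by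
  obtain ⟨hK, h1, h2, hsub, -⟩ := wK_facts E hi
  rw [← wK_mul_wL E hi, hK.length_conj (par_mono cs hsub (E.hwL (i + 1) hi).1)]

lemma zz_succ {i : ℕ} (hi : i < m) :
    zz E (i + 1) = zz E i * (E.wL i * E.wK (i + 1)) := by
  have hx := E.hx (i + 1) (by omega) hi
  rw [Nat.add_sub_cancel] at hx
  have hK := (wK_facts E hi).1.mul_self
  have hL := (E.hwL i hi.le).mul_self
  have h := wK_mul_wL E hi
  have h' : E.wK (i + 1) * E.wL (i + 1) = E.wL i * E.wK (i + 1) := by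
    rw [← h, mul_assoc, hK, mul_one]
  rw [zz, zz, hx, mul_assoc _ (E.wK (i + 1)), h', ← mul_assoc]

lemma x_eq {i : ℕ} (hi : i ≤ m) : E.x i = zz E i * E.wL i := by
  rw [zz, mul_assoc, (E.hwL i hi).mul_self, mul_one]

lemma length_step {i : ℕ} (hi : i < m)
    (h : cs.length (E.x i) = cs.length (zz E i) + cs.length (E.wL i)) :
    ∀ u ∈ par cs (E.Lset i ∪ {E.letter (i + 1)}),
      cs.length (zz E i * u) = cs.length (zz E i) + cs.length u := by
  intro u hu
  have hK := (wK_facts E hi).1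
  have hx := E.hx (i + 1) (by omega) hi
  have hr := E.hred (i + 1) (by omega) hi
  rw [Nat.add_sub_cancel] at hx hr
  change _ = zz E i * _ at hx
  have h1 := hK.length_mul (inv_mem hu)
  rw [cs.length_inv] at h1
  have h2 := cs.length_mul_le (zz E i * u) (u⁻¹ * E.wK (i + 1))
  have e : zz E i * u * (u⁻¹ * E.wK (i + 1)) = zz E i * E.wK (i + 1) := by group
  rw [e, ← hx] at h2
  have h3 := cs.length_mul_le (zz E i) u
  omega

lemma length_x {i : ℕ} (hi : i ≤ m) :
    cs.length (E.x i) = cs.length (zz E i) + cs.length (E.wL i) := by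
  induction i with
  | zero => rw [zz_zero, E.hx0]; simp
  | succ i ih =>
    have hi' : i < m := hi
    have ih' := ih hi'.le
    have hs := length_step E hi' ih'
    have hK := (wK_facts E hi').1
    have hwL : E.wL i ∈ par cs (E.Lset i ∪ {E.letter (i + 1)}) :=
      par_mono cs Set.subset_union_left (E.hwL i hi'.le).1
    have h1 := hs _ (mul_mem hwL hK.1)
    rw [← zz_succ E hi'] at h1
    have h2 := hK.length_mul hwL
    have hr := E.hred (i + 1) (by omega) hi
    rw [Nat.add_sub_cancel] at hr
    have h3 := length_wL E hi'
    omega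

lemma zz_add {i : ℕ} (hi : i < m) {u : W}
    (hu : u ∈ par cs (E.Lset i ∪ {E.letter (i + 1)})) :
    cs.length (zz E i * u) = cs.length (zz E i) + cs.length u :=
  length_step E hi (length_x E hi.le) u hu

lemma v_mem {i : ℕ} (hi : i < m) :
    E.wL i * E.wK (i + 1) ∈ par cs (E.Lset i ∪ {E.letter (i + 1)}) :=
  mul_mem (par_mono cs Set.subset_union_left (E.hwL i hi.le).1) (wK_facts E hi).1.1

lemma zz_conj {i : ℕ} (hi : i ≤ m) (w : W) :
    w ∈ par cs I ↔ (zz E i)⁻¹ * w * zz E i ∈ par cs (E.Lset i) := by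
  induction i with
  | zero => rw [zz_zero, E.hL0]; simp
  | succ i ih =>
    have hi' : i < m := hi
    obtain ⟨hK, h1, h2, -⟩ := wK_facts E hi'
    have hL := E.hwL i hi'.le
    rw [ih hi'.le, zz_succ E hi']
    set q := (zz E i)⁻¹ * w * zz E i with hq
    have e : (zz E i * (E.wL i * E.wK (i + 1)))⁻¹ * w * (zz E i * (E.wL i * E.wK (i + 1))) =
        E.wK (i + 1) * ((E.wL i)⁻¹ * q * E.wL i) * E.wK (i + 1) := by
      nth_rewrite 3 [← hK.inv_eq]
      rw [hq]; group
    rw [e]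
    have e2 : q ∈ par cs (E.Lset i) ↔ (E.wL i)⁻¹ * q * E.wL i ∈ par cs (E.Lset i) := by
      rw [Subgroup.mul_mem_cancel_right _ hL.1, Subgroup.mul_mem_cancel_left _ (inv_mem hL.1)]
    rw [e2]
    refine ⟨h1 _, fun h => ?_⟩
    have := h2 _ h
    convert this using 1
    generalize (E.wL i)⁻¹ * q * E.wL i = y
    have hh := hK.mul_self
    calc y = 1 * y * 1 := by simp
      _ = _ := by rw [← hh]; simp only [mul_assoc]

/-- Reflections of `P_i` outside `W_I` are not inversions of `z_i`. -/
lemma N_before {i : ℕ} (hi : i < m) {t : W} (ht : cs.IsReflection t)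
    (h1 : (zz E i)⁻¹ * t * zz E i ∈ par cs (E.Lset i ∪ {E.letter (i + 1)})) :
    N cs (zz E i) t = 0 := by
  rw [N_eq_zero_iff cs ht]
  have h2 := zz_add E hi h1
  have e : zz E i * ((zz E i)⁻¹ * t * zz E i) = t * zz E i := by group
  rw [e] at h2
  have := ht.length_mul_right_ne (zz E i)
  omega

/-- Reflections of `P_i` outside `W_I` are inversions of `z_{i+1}`. -/
lemma N_after {i : ℕ} (hi : i < m) {t : W} (ht : cs.IsReflection t) (htI : t ∉ par cs I)
    (h1 : (zz E i)⁻¹ * t * zz E i ∈ par cs (E.Lset i ∪ {E.letter (i + 1)})) :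
    N cs (zz E (i + 1)) t = 1 := by
  rw [zz_succ E hi, N_mul, N_before E hi ht h1, zero_add, N_mul]
  have hL := E.hwL i hi.le
  have hK := (wK_facts E hi).1
  rw [zz_conj E hi.le] at htI
  set r := (zz E i)⁻¹ * t * zz E i with hr
  have hrr : cs.IsReflection r := by simpa [hr] using ht.conj (zz E i)⁻¹
  have h3 : N cs (E.wL i) r = 0 := by
    by_contra h
    exact htI (mem_par_of_N cs hL.1 h)
  have hLK := par_mono cs (K' := E.Lset i ∪ {E.letter (i + 1)}) Set.subset_union_left hL.1
  rw [h3, zero_add]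
  apply hK.N_eq_one
  · simpa using hrr.conj (E.wL i)⁻¹
  · exact mul_mem (mul_mem (inv_mem hLK) h1) hLK

lemma N_persist {i k : ℕ} (hik : i ≤ k) (hk : k ≤ m) {t : W} (ht : cs.IsReflection t)
    (h : N cs (zz E i) t = 1) : N cs (zz E k) t = 1 := by
  induction k, hik using Nat.le_induction with
  | base => exact h
  | succ k hik ih =>
    have hk' : k < m := hk
    have := ih hk'.le
    rw [N_eq_one_iff cs ht] at this ⊢
    rw [zz_succ E hk', zz_add E hk' (v_mem E hk'), ← mul_assoc]
    have := cs.length_mul_le (t * zz E k) (E.wL k * E.wK (k + 1))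
    omega

lemma exists_step {k : ℕ} (hk : k ≤ m) {t : W} (h : N cs (zz E k) t ≠ 0) :
    ∃ j, j < m ∧ (zz E j)⁻¹ * t * zz E j ∈ par cs (E.Lset j ∪ {E.letter (j + 1)}) := by
  induction k with
  | zero => rw [zz_zero] at h; simp at h
  | succ k ih =>
    have hk' : k < m := hk
    by_cases h0 : N cs (zz E k) t = 0
    · rw [zz_succ E hk', N_mul, h0, zero_add] at h
      exact ⟨k, hk', mem_par_of_N cs (v_mem E hk') h⟩
    · exact ih hk'.le h0

/-- The wall crossed at step `i + 1`. -/
def wall (i : ℕ) : W := zz E i * cs.simple (E.letter (i + 1)) * (zz E i)⁻¹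

lemma wall_refl (i : ℕ) : cs.IsReflection (wall E i) := (cs.isReflection_simple _).conj _

lemma wall_conj (i : ℕ) : (zz E i)⁻¹ * wall E i * zz E i = cs.simple (E.letter (i + 1)) := by
  rw [wall]; group

lemma wall_mem (i : ℕ) :
    (zz E i)⁻¹ * wall E i * zz E i ∈ par cs (E.Lset i ∪ {E.letter (i + 1)}) := by
  rw [wall_conj]
  exact simple_mem_par cs (Or.inr rfl)

lemma wall_not_mem {i : ℕ} (hi : i < m) : wall E i ∉ par cs I := by
  rw [zz_conj E hi.le, wall_conj]
  intro h
  exact (wK_facts E hi).2.2.2.2 (mem_of_simple_mem_par cs h)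

lemma wall_distinct {i k : ℕ} (hik : i < k) (hk : k < m) :
    (zz E i)⁻¹ * wall E k * zz E i ∉ par cs (E.Lset i ∪ {E.letter (i + 1)}) := by
  intro h
  have h1 := N_after E (hik.trans hk) (wall_refl E k) (wall_not_mem E hk) h
  have h2 := N_persist E (k := k) (by omega) hk.le (wall_refl E k) h1
  rw [N_before E hk (wall_refl E k) (wall_mem E k)] at h2
  exact zero_ne_one h2

lemma width_le {m' : ℕ} (E' : RAtomExpr cs I J m') (h : E.x m = E'.x m') : m ≤ m' := by
  have hz : zz E m = zz E' m' := by
    have h1 := E.hwL m le_rfl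
    have h2 := E'.hwL m' le_rfl
    rw [E.hLm] at h1
    rw [E'.hLm] at h2
    rw [zz, zz, h, h1.unique h2]
  have hex : ∀ i : Fin m, ∃ j : Fin m', (zz E' j)⁻¹ * wall E i * zz E' j ∈
      par cs (E'.Lset j ∪ {E'.letter (j + 1)}) := by
    intro i
    have h1 := N_after E i.2 (wall_refl E i) (wall_not_mem E i.2) (wall_mem E i)
    have h2 := N_persist E (k := m) i.2 le_rfl (wall_refl E i) h1
    rw [hz] at h2
    obtain ⟨j, hj, hj'⟩ := exists_step E' le_rfl (t := wall E i) (by rw [h2]; exact one_ne_zero)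
    exact ⟨⟨j, hj⟩, hj'⟩
  choose φ hφ using hex
  have key : ∀ i k : Fin m, i < k → φ i ≠ φ k := by
    intro i k hik he
    have hi := hφ i
    have hk := hφ k
    rw [← he] at hk
    set j := φ i
    -- `P'_j ⊆ P_i`
    let g : W := (zz E' j)⁻¹ * zz E i
    have conv : ∀ w, g⁻¹ * ((zz E' j)⁻¹ * w * zz E' j) * g = (zz E i)⁻¹ * w * zz E i := by
      intro w; simp only [g]; group
    have hfin := E'.hfinK (j + 1) (by omega) j.2
    rw [Nat.add_sub_cancel] at hfin
    have := par_le_of_mem cs (N' := E.Lset i ∪ {E.letter (i + 1)}) hfin g ?_ hi ?_ ?_ _ hk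
    · rw [conv] at this
      exact wall_distinct E hik k.2 this
    · intro w hw
      have e : w = (zz E' j)⁻¹ * (zz E' j * w * (zz E' j)⁻¹) * zz E' j := by group
      rw [e] at hw ⊢
      rw [← zz_conj E' j.2.le, zz_conj E i.2.le] at hw
      rw [conv]
      exact par_mono cs Set.subset_union_left hw
    · rw [← zz_conj E' j.2.le]
      exact wall_not_mem E i.2
    · rw [conv]
      exact wall_mem E i
  have hinj : Function.Injective φ := by
    intro i k h
    rcases lt_trichotomy i k with hlt | heq | hgt
    · exact absurd h (key i k hlt)
    · exact heq
    · exact absurd h.symm (key k i hgt)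
  simpa using Fintype.card_le_of_injective φ hinj

end Atomic

theorem statement_8 (cs : CoxeterSystem M W) (I J : Set B)
    (hI : Finitary cs I) (hJ : Finitary cs J)
    (y pbar : W) (hcore : IsCore cs I y J)
    (hmax : IsMaxOf cs (dcos cs I y J) pbar)
    (m m' : ℕ) (E : RAtomExpr cs I J m) (E' : RAtomExpr cs I J m')
    (hE : E.x m = pbar) (hE' : E'.x m' = pbar) :
    m = m' := by
  exact le_antisymm (width_le E E' (hE.trans hE'.symm)) (width_le E' E (hE'.trans hE.symm))

end CoxeterAtoms
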